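/- Let P be a locally finite graded poset with levels Φ_k (rank function), and define linear operators on the free vector space C[Φ] by Dx = Σ_{y ⋖ x} y and Ux = Σ_{x ⋖ y} y (sums over elements covered by x, resp. covering x). Then DU − UD = I holds if and only if P satisfies: (1) for distinct x, y, the number of elements covering both x and y equals the number of elements covered by both x and y; and (2) if x covers exactly k elements then x is covered by exactly k+1 elements. -/

import Mathlib

/-- The up operator on the free vector space on a poset:
`U x = Σ_{x ⋖ y} y`, extended by linearity. -/
noncomputable def upOp (Φ : Type*) [PartialOrder Φ]
    [∀ x : Φ, Fintype {y : Φ // x ⋖ y}] :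
    (Φ →₀ ℚ) →ₗ[ℚ] (Φ →₀ ℚ) :=
  Finsupp.lift (Φ →₀ ℚ) ℚ Φ
    (fun x => ∑ y : {y : Φ // x ⋖ y}, Finsupp.single (y : Φ) (1 : ℚ))

/-- The down operator on the free vector space on a poset:
`D x = Σ_{y ⋖ x} y`, extended by linearity. -/
noncomputable def downOp (Φ : Type*) [PartialOrder Φ]
    [∀ x : Φ, Fintype {y : Φ // y ⋖ x}] :
    (Φ →₀ ℚ) →ₗ[ℚ] (Φ →₀ ℚ) :=
  Finsupp.lift (Φ →₀ ℚ) ℚ Φ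
    (fun x => ∑ y : {y : Φ // y ⋖ x}, Finsupp.single (y : Φ) (1 : ℚ))

theorem sum_single_subtype_apply {Φ : Type*} {p : Φ → Prop} [Fintype {z : Φ // p z}] [DecidablePred p]
    (y : Φ) :
    (∑ z : {z : Φ // p z}, Finsupp.single (z : Φ) (1 : ℚ)) y = if p y then 1 else 0 := by
  classical
  rw [Finsupp.finsetSum_apply]
  simp only [Finsupp.single_apply]
  split_ifs with h
  · rw [Finset.sum_eq_single (⟨y, h⟩ : {z : Φ // p z})]
    · simp
    · intro b _ hb
      exact if_neg fun e => hb (Subtype.ext e)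
    · simp
  · exact Finset.sum_eq_zero fun z _ => if_neg fun e : (z : Φ) = y => h (e ▸ z.2)

theorem sum_ite_subtype_eq_card {Φ : Type*} (p q : Φ → Prop) [Fintype {z : Φ // p z}] [DecidablePred q] :
    (∑ z : {z : Φ // p z}, if q z then (1 : ℚ) else 0) = Nat.card {z : Φ // p z ∧ q z} := by
  rw [Finset.sum_boole, ← Fintype.card_subtype, ← Nat.card_eq_fintype_card,
    Nat.card_congr (Equiv.subtypeSubtypeEquivSubtypeInter p q)]

section

variable {Φ : Type*} [PartialOrder Φ]

theorem upOp_single [∀ x : Φ, Fintype {y : Φ // x ⋖ y}] (x : Φ) :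
    upOp Φ (Finsupp.single x 1) = ∑ y : {y : Φ // x ⋖ y}, Finsupp.single (y : Φ) (1 : ℚ) := by
  simp [upOp]

theorem downOp_single [∀ x : Φ, Fintype {y : Φ // y ⋖ x}] (x : Φ) :
    downOp Φ (Finsupp.single x 1) = ∑ y : {y : Φ // y ⋖ x}, Finsupp.single (y : Φ) (1 : ℚ) := by
  simp [downOp]

variable [∀ x : Φ, Fintype {y : Φ // x ⋖ y}] [∀ x : Φ, Fintype {y : Φ // y ⋖ x}]

theorem downOp_upOp_single_apply (x y : Φ) :
    downOp Φ (upOp Φ (Finsupp.single x 1)) y = Nat.card {z : Φ // x ⋖ z ∧ y ⋖ z} := by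
  classical
  simp only [upOp_single, map_sum, downOp_single]
  rw [Finsupp.finsetSum_apply, ← sum_ite_subtype_eq_card]
  exact Finset.sum_congr rfl fun z _ => sum_single_subtype_apply y

theorem upOp_downOp_single_apply (x y : Φ) :
    upOp Φ (downOp Φ (Finsupp.single x 1)) y = Nat.card {z : Φ // z ⋖ x ∧ z ⋖ y} := by
  classical
  simp only [downOp_single, map_sum, upOp_single]
  rw [Finsupp.finsetSum_apply, ← sum_ite_subtype_eq_card]
  exact Finset.sum_congr rfl fun z _ => sum_single_subtype_apply y

theorem downOp_comp_upOp_sub_eq_id_iff [DecidableEq Φ] :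
    downOp Φ ∘ₗ upOp Φ - upOp Φ ∘ₗ downOp Φ = LinearMap.id ↔
      ∀ x y : Φ, (Nat.card {z : Φ // x ⋖ z ∧ y ⋖ z} : ℚ) - Nat.card {z : Φ // z ⋖ x ∧ z ⋖ y} =
        if x = y then 1 else 0 := by
  constructor
  · intro h x y
    have := DFunLike.congr_fun (LinearMap.congr_fun h (Finsupp.single x 1)) y
    simpa [downOp_upOp_single_apply, upOp_downOp_single_apply, Finsupp.single_apply] using this
  · intro h
    refine Finsupp.lhom_ext' fun x => LinearMap.ext_ring (Finsupp.ext fun y => ?_)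
    simpa [downOp_upOp_single_apply, upOp_downOp_single_apply, Finsupp.single_apply] using h x y

end

/-- Stanley's characterization of (r = 1) differential posets: for a locally finite
graded poset `Φ`, the operators `U`, `D` on `ℚ[Φ]` satisfy `DU − UD = I` iff
(1) for distinct `x, y` the number of elements covering both equals the number of
elements covered by both, and (2) every `x` covering exactly `k` elements is covered
by exactly `k + 1` elements. -/
theorem differential_poset_characterization
    (Φ : Type*) [PartialOrder Φ]
    [∀ x : Φ, Fintype {y : Φ // x ⋖ y}] [∀ x : Φ, Fintype {y : Φ // y ⋖ x}]
    (rank : Φ → ℕ) (hrank : ∀ x y : Φ, x ⋖ y → rank y = rank x + 1) :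
    downOp Φ ∘ₗ upOp Φ - upOp Φ ∘ₗ downOp Φ = LinearMap.id ↔
      ((∀ x y : Φ, x ≠ y →
          Nat.card {z : Φ // x ⋖ z ∧ y ⋖ z} = Nat.card {z : Φ // z ⋖ x ∧ z ⋖ y}) ∧
        (∀ x : Φ, Nat.card {z : Φ // z ⋖ x} + 1 = Nat.card {z : Φ // x ⋖ z})) := by
  classical
  rw [downOp_comp_upOp_sub_eq_id_iff]
  constructor
  · intro h
    refine ⟨fun x y hxy => ?_, fun x => ?_⟩
    · have := h x y
      rw [if_neg hxy, sub_eq_zero] at this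
      exact_mod_cast this
    · have := h x x
      simp only [and_self, if_true, sub_eq_iff_eq_add'] at this
      exact_mod_cast this.symm
  · rintro ⟨h₁, h₂⟩ x y
    by_cases hxy : x = y
    · subst hxy
      simp only [and_self, if_true, sub_eq_iff_eq_add']
      exact_mod_cast (h₂ x).symm
    · rw [if_neg hxy, h₁ x y hxy, sub_self]
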